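/- Let C̄ > 0 and let w be twice continuously differentiable on an open neighborhood of the closure of Q_T with w = 0 on S_T, satisfying the differential inequality |w_t − Lw| ≤ C̄(|∇w| + |w|) at every point of Q_T. Then there exist constants C₁ > 0 and ν₁ > 1, depending only on n, T, Ω, μ₁, μ₂, the C¹-norms of the a_{ij}, and C̄, such that for every ν ≥ ν₁ and every τ ∈ (0,T): ∫_{Q_{Tτ}} (|∇w|² + w²) dx dt ≤ C₁ exp(3(T+1)^ν) ∫_Ω w(x,T)² dx + C₁ exp(−2(τ+1)^ν) ∫_Ω |∇w(x,0)|² dx. -/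

import Mathlib

open MeasureTheory Real Set

/-- Partial derivative in time of a function `u(x,t)`. -/
noncomputable def partialT {n : ℕ} (u : (Fin n → ℝ) → ℝ → ℝ) (x : Fin n → ℝ) (t : ℝ) : ℝ :=
  deriv (fun s => u x s) t

/-- Partial derivative in the `i`-th spatial variable of a function `u(x,t)`. -/
noncomputable def partialX {n : ℕ} (i : Fin n) (u : (Fin n → ℝ) → ℝ → ℝ)
    (x : Fin n → ℝ) (t : ℝ) : ℝ :=
  deriv (fun s => u (Function.update x i s) t) (x i)

/-- The second order elliptic operator `(Lu)(x,t) = Σ_{i,j} a_{ij}(x,t) u_{x_i x_j}(x,t)`. -/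
noncomputable def Lop {n : ℕ} (a : Fin n → Fin n → (Fin n → ℝ) → ℝ → ℝ)
    (u : (Fin n → ℝ) → ℝ → ℝ) (x : Fin n → ℝ) (t : ℝ) : ℝ :=
  ∑ i, ∑ j, a i j x t * partialX i (partialX j u) x t

/-- The derivative of `f` in the `i`-th space direction. -/
noncomputable def spaceDeriv {n : ℕ} (i : Fin n) (f : (Fin n → ℝ) × ℝ → ℝ)
    (p : (Fin n → ℝ) × ℝ) : ℝ :=
  fderiv ℝ f p (Pi.single i 1, 0)

/-- The derivative of `f` in the time direction. -/
noncomputable def timeDeriv {n : ℕ} (f : (Fin n → ℝ) × ℝ → ℝ) (p : (Fin n → ℝ) × ℝ) : ℝ :=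
  fderiv ℝ f p (0, 1)

section Derivatives

variable {n : ℕ} {f g : (Fin n → ℝ) × ℝ → ℝ} {p : (Fin n → ℝ) × ℝ}
  {V : Set ((Fin n → ℝ) × ℝ)}

theorem hasDerivAt_slice_space {x : Fin n → ℝ} {t : ℝ}
    (hf : DifferentiableAt ℝ f (x, t)) (i : Fin n) :
    HasDerivAt (fun s => f (Function.update x i s, t)) (spaceDeriv i f (x, t)) (x i) := by
  have h1 : HasDerivAt (fun s : ℝ => ((Function.update x i s, t) : (Fin n → ℝ) × ℝ))
      (Pi.single i 1, 0) (x i) := (hasDerivAt_update x i (x i)).prodMk (hasDerivAt_const _ _)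
  have h2 : HasFDerivAt f (fderiv ℝ f (x, t)) (Function.update x i (x i), t) := by
    simpa using hf.hasFDerivAt
  exact h2.comp_hasDerivAt (f := fun s : ℝ => (Function.update x i s, t)) (x i) h1

theorem hasDerivAt_slice_time {x : Fin n → ℝ} {t : ℝ} (hf : DifferentiableAt ℝ f (x, t)) :
    HasDerivAt (fun s => f (x, s)) (timeDeriv f (x, t)) t :=
  hf.hasFDerivAt.comp_hasDerivAt t ((hasDerivAt_const t x).prodMk (hasDerivAt_id t))

theorem partialX_eq_spaceDeriv {u : (Fin n → ℝ) → ℝ → ℝ} {x : Fin n → ℝ} {t : ℝ} (i : Fin n)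
    (hf : DifferentiableAt ℝ (fun p : (Fin n → ℝ) × ℝ => u p.1 p.2) (x, t)) :
    partialX i u x t = spaceDeriv i (fun p => u p.1 p.2) (x, t) :=
  (hasDerivAt_slice_space hf i).deriv

theorem partialT_eq_timeDeriv {u : (Fin n → ℝ) → ℝ → ℝ} {x : Fin n → ℝ} {t : ℝ}
    (hf : DifferentiableAt ℝ (fun p : (Fin n → ℝ) × ℝ => u p.1 p.2) (x, t)) :
    partialT u x t = timeDeriv (fun p => u p.1 p.2) (x, t) :=
  (hasDerivAt_slice_time hf).deriv

theorem spaceDeriv_congr (i : Fin n) (h : f =ᶠ[nhds p] g) :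
    spaceDeriv i f p = spaceDeriv i g p := by
  simp only [spaceDeriv, h.fderiv_eq]

theorem partialX_partialX_eq_spaceDeriv {u : (Fin n → ℝ) → ℝ → ℝ} (hV : IsOpen V)
    (hu : ContDiffOn ℝ 2 (fun p : (Fin n → ℝ) × ℝ => u p.1 p.2) V) (hp : p ∈ V) (i j : Fin n) :
    partialX i (partialX j u) p.1 p.2
      = spaceDeriv i (spaceDeriv j (fun p => u p.1 p.2)) p := by
  have heq : (fun q : (Fin n → ℝ) × ℝ => partialX j u q.1 q.2)
      =ᶠ[nhds p] spaceDeriv j (fun p => u p.1 p.2) := by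
    filter_upwards [hV.mem_nhds hp] with q hq
    exact partialX_eq_spaceDeriv j ((hu.differentiableOn (by norm_num)).differentiableAt
      (hV.mem_nhds hq))
  have hd : DifferentiableAt ℝ (spaceDeriv j (fun p => u p.1 p.2)) p :=
    (((hu.fderiv_of_isOpen hV (m := 1) (by norm_num)).clm_apply
      contDiffOn_const).differentiableOn (by norm_num)).differentiableAt (hV.mem_nhds hp)
  rw [partialX_eq_spaceDeriv i (hd.congr_of_eventuallyEq heq), spaceDeriv_congr i heq]

theorem ContDiffOn.spaceDeriv {m k : WithTop ℕ∞} (hf : ContDiffOn ℝ k f V) (hV : IsOpen V)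
    (h : m + 1 ≤ k) (i : Fin n) : ContDiffOn ℝ m (spaceDeriv i f) V :=
  (hf.fderiv_of_isOpen hV h).clm_apply contDiffOn_const

theorem ContDiffOn.timeDeriv {m k : WithTop ℕ∞} (hf : ContDiffOn ℝ k f V) (hV : IsOpen V)
    (h : m + 1 ≤ k) : ContDiffOn ℝ m (timeDeriv f) V :=
  (hf.fderiv_of_isOpen hV h).clm_apply contDiffOn_const

theorem spaceDeriv_timeDeriv_comm (hV : IsOpen V) (hf : ContDiffOn ℝ 2 f V) (hp : p ∈ V)
    (i : Fin n) : spaceDeriv i (timeDeriv f) p = timeDeriv (spaceDeriv i f) p := by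
  have hd : DifferentiableAt ℝ (fderiv ℝ f) p :=
    ((hf.fderiv_of_isOpen hV (m := 1) (by norm_num)).differentiableOn
      (by norm_num)).differentiableAt (hV.mem_nhds hp)
  have hs : IsSymmSndFDerivAt ℝ f p :=
    (hf.contDiffAt (hV.mem_nhds hp)).isSymmSndFDerivAt (by simp)
  have key : ∀ v w, fderiv ℝ (fun q => fderiv ℝ f q v) p w = fderiv ℝ (fderiv ℝ f) p w v := by
    intro v w
    rw [fderiv_clm_apply hd (differentiableAt_const v)]
    simp
  change fderiv ℝ (fun q => fderiv ℝ f q (0, 1)) p (Pi.single i 1, 0)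
    = fderiv ℝ (fun q => fderiv ℝ f q (Pi.single i 1, 0)) p (0, 1)
  rw [key, key, hs.eq]

theorem spaceDeriv_mul_time {θ : ℝ → ℝ} (hf : DifferentiableAt ℝ f p)
    (hθ : DifferentiableAt ℝ θ p.2) (i : Fin n) :
    spaceDeriv i (fun q => f q * θ q.2) p = spaceDeriv i f p * θ p.2 := by
  have h := hf.hasFDerivAt.mul
    (hθ.hasDerivAt.comp_hasFDerivAt p (hasFDerivAt_snd (𝕜 := ℝ) (E := Fin n → ℝ) (F := ℝ)))
  change fderiv ℝ (f * (θ ∘ Prod.snd)) p _ = _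
  rw [h.fderiv]
  simp [spaceDeriv, mul_comm]

theorem timeDeriv_mul_time {θ : ℝ → ℝ} {θ' : ℝ} (hf : DifferentiableAt ℝ f p)
    (hθ : HasDerivAt θ θ' p.2) :
    timeDeriv (fun q => f q * θ q.2) p = timeDeriv f p * θ p.2 + f p * θ' := by
  have h := hf.hasFDerivAt.mul
    (hθ.comp_hasFDerivAt p (hasFDerivAt_snd (𝕜 := ℝ) (E := Fin n → ℝ) (F := ℝ)))
  change fderiv ℝ (f * (θ ∘ Prod.snd)) p _ = _
  rw [h.fderiv]
  simp [timeDeriv]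
  ring

end Derivatives

theorem integrableOn_of_continuousOn_closure {X : Type*} [PseudoMetricSpace X] [ProperSpace X]
    [MeasurableSpace X] [OpensMeasurableSpace X] {μ : Measure X} [IsFiniteMeasureOnCompacts μ]
    {s : Set X} (hs : Bornology.IsBounded s) {f : X → ℝ} (hf : ContinuousOn f (closure s)) :
    IntegrableOn f s μ :=
  (hf.integrableOn_compact' hs.isCompact_closure isClosed_closure.measurableSet).mono_set
    subset_closure

theorem closure_cylinder {X : Type*} [TopologicalSpace X] (Ω : Set X) {T : ℝ} (hT : 0 < T) :
    closure (Ω ×ˢ Ioo (0 : ℝ) T) = closure Ω ×ˢ Icc 0 T := by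
  rw [closure_prod_eq, closure_Ioo hT.ne]

theorem continuousOn_slice {X : Type*} [TopologicalSpace X] {Ω : Set X} {T t : ℝ} (hT : 0 < T)
    {V : Set (X × ℝ)} (hsub : closure (Ω ×ˢ Ioo (0 : ℝ) T) ⊆ V) {f : X × ℝ → ℝ}
    (hf : ContinuousOn f V) (ht : t ∈ Icc 0 T) : ContinuousOn (fun x => f (x, t)) (closure Ω) :=
  hf.comp (by fun_prop) fun x hx => hsub (by rw [closure_cylinder Ω hT]; exact ⟨hx, ht⟩)

theorem setIntegral_timeDeriv {n : ℕ} {Ω : Set (Fin n → ℝ)} (hΩ : IsOpen Ω)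
    (hb : Bornology.IsBounded Ω) {T : ℝ} (hT : 0 < T) {V : Set ((Fin n → ℝ) × ℝ)}
    (hV : IsOpen V) (hsub : closure (Ω ×ˢ Ioo (0 : ℝ) T) ⊆ V) {H : (Fin n → ℝ) × ℝ → ℝ}
    (hH : ContDiffOn ℝ 1 H V) :
    ∫ p in Ω ×ˢ Ioo 0 T, timeDeriv H p = (∫ x in Ω, H (x, T)) - ∫ x in Ω, H (x, 0) := by
  have hc : ContinuousOn (timeDeriv H) V := (hH.timeDeriv (m := 0) hV (by norm_num)).continuousOn
  have hint : IntegrableOn (timeDeriv H) (Ω ×ˢ Ioo 0 T) :=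
    integrableOn_of_continuousOn_closure (hb.prod (Metric.isBounded_Ioo 0 T)) (hc.mono hsub)
  rw [Measure.volume_eq_prod] at hint ⊢
  rw [setIntegral_prod _ hint, ← integral_sub]
  · refine setIntegral_congr_fun hΩ.measurableSet fun x hx => ?_
    have hmem : ∀ t ∈ Icc 0 T, (x, t) ∈ V := fun t ht =>
      hsub (by rw [closure_cylinder Ω hT]; exact ⟨subset_closure hx, ht⟩)
    rw [← integral_Ioc_eq_integral_Ioo, ← intervalIntegral.integral_of_le hT.le]
    refine intervalIntegral.integral_eq_sub_of_hasDerivAt (f := fun s => H (x, s)) ?_ ?_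
    · intro t ht
      rw [uIcc_of_le hT.le] at ht
      exact hasDerivAt_slice_time ((hH.differentiableOn (by norm_num)).differentiableAt
        (hV.mem_nhds (hmem t ht)))
    · refine ContinuousOn.intervalIntegrable ?_
      rw [uIcc_of_le hT.le]
      exact hc.comp (by fun_prop) hmem
  · exact integrableOn_of_continuousOn_closure hb
      (continuousOn_slice hT hsub hH.continuousOn ⟨hT.le, le_rfl⟩)
  · exact integrableOn_of_continuousOn_closure hb
      (continuousOn_slice hT hsub hH.continuousOn ⟨le_rfl, hT.le⟩)

theorem energy_pointwise {n : ℕ} (a aT aX h : Fin n → Fin n → ℝ) (d dt : Fin n → ℝ)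
    (u ut g g' k μ C M : ℝ) (hsym : ∀ i j, a i j = a j i) (hM : 0 ≤ M) (hk : 0 ≤ k)
    (hell : μ * ∑ i, d i ^ 2 ≤ ∑ i, ∑ j, a i j * d i * d j)
    (haT : ∀ i j, |aT i j| ≤ M) (haX : ∀ i j, |aX i j| ≤ M)
    (hf : |ut - (∑ i, ∑ j, a i j * h i j) - g * u| ≤ C * (√(∑ i, d i ^ 2) + |u|))
    (hkμ : M * n + 2 * (4 * C ^ 2 + 2 * (M ^ 2 * n ^ 3)) + 1 ≤ 2 * k * μ)
    (hg : 1 + 2 * (4 * C ^ 2 + 2 * (M ^ 2 * n ^ 3)) + k ^ 2 + 2 * k * g ≤ g') :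
    (∑ i, d i ^ 2) + u ^ 2 ≤
      2 * ∑ j, ((dt j + k * d j) * (∑ i, a j i * d i)
        + (ut + k * u) * ∑ i, (aX j i * d i + a j i * h j i))
      - ((∑ i, ∑ j, (aT i j * d i * d j + a i j * dt i * d j + a i j * d i * dt j))
        - g' * u ^ 2 + 2 * (k - g) * u * ut) := by
  set S := ∑ i, d i ^ 2 with hS
  have hS0 : 0 ≤ S := Finset.sum_nonneg fun i _ => sq_nonneg _
  set Lu := ∑ i, ∑ j, a i j * h i j with hLu
  set b := ∑ j, ∑ i, aX j i * d i with hb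
  set Q := ∑ i, ∑ j, a i j * d i * d j with hQ
  set R := ∑ i, ∑ j, aT i j * d i * d j with hR
  set P := ∑ i, ∑ j, a i j * d i * dt j with hP
  set N := ∑ i, |d i| with hN
  have hN2 : N ^ 2 ≤ n * S := by
    have := sq_sum_le_card_mul_sum_sq (s := Finset.univ) (f := fun i => |d i|)
    simpa [sq_abs] using this
  have hN0 : 0 ≤ N := Finset.sum_nonneg fun i _ => abs_nonneg _
  have hRle : R ≤ M * (n * S) := by
    calc R ≤ ∑ i, ∑ j, M * (|d i| * |d j|) := by
          refine Finset.sum_le_sum fun i _ => Finset.sum_le_sum fun j _ => ?_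
          calc aT i j * d i * d j ≤ |aT i j * d i * d j| := le_abs_self _
            _ = |aT i j| * (|d i| * |d j|) := by rw [abs_mul, abs_mul, mul_assoc]
            _ ≤ _ := by gcongr; exact haT i j
      _ = M * N ^ 2 := by
          rw [sq, hN, Finset.sum_mul_sum, Finset.mul_sum]
          simp only [Finset.mul_sum]
      _ ≤ _ := by gcongr
  have hbabs : |b| ≤ n * (M * N) := by
    calc |b| ≤ ∑ j : Fin n, ∑ i, M * |d i| := by
          refine (Finset.abs_sum_le_sum_abs _ _).trans (Finset.sum_le_sum fun j _ => ?_)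
          refine (Finset.abs_sum_le_sum_abs _ _).trans (Finset.sum_le_sum fun i _ => ?_)
          rw [abs_mul]; gcongr; exact haX j i
      _ = _ := by simp [← Finset.mul_sum, hN]
  have hb2 : b ^ 2 ≤ M ^ 2 * n ^ 3 * S := by
    have : b ^ 2 ≤ (n * (M * N)) ^ 2 := sq_le_sq' (neg_le_of_abs_le hbabs) (le_of_abs_le hbabs)
    calc b ^ 2 ≤ (n * (M * N)) ^ 2 := this
      _ = n ^ 2 * M ^ 2 * N ^ 2 := by ring
      _ ≤ n ^ 2 * M ^ 2 * (n * S) := by gcongr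
      _ = _ := by ring
  have hdiv : ∑ j, ((dt j + k * d j) * (∑ i, a j i * d i)
        + (ut + k * u) * ∑ i, (aX j i * d i + a j i * h j i))
      = P + k * Q + (ut + k * u) * (b + Lu) := by
    have e1 : ∑ j, (dt j + k * d j) * (∑ i, a j i * d i) = P + k * Q := by
      have hPc : P = ∑ j, ∑ i, a j i * d i * dt j := by
        rw [hP, Finset.sum_comm]
        refine Finset.sum_congr rfl fun j _ => Finset.sum_congr rfl fun i _ => ?_
        rw [hsym i j]
      rw [hPc, hQ, Finset.mul_sum, ← Finset.sum_add_distrib]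
      refine Finset.sum_congr rfl fun j _ => ?_
      rw [Finset.mul_sum, Finset.mul_sum, ← Finset.sum_add_distrib]
      exact Finset.sum_congr rfl fun i _ => by ring
    rw [Finset.sum_add_distrib, e1, ← Finset.mul_sum]
    simp only [Finset.sum_add_distrib]
    rfl
  have htime : ∑ i, ∑ j, (aT i j * d i * d j + a i j * dt i * d j + a i j * d i * dt j)
      = R + 2 * P := by
    have hPc : ∑ i, ∑ j, a i j * dt i * d j = P := by
      rw [hP, Finset.sum_comm]
      refine Finset.sum_congr rfl fun j _ => Finset.sum_congr rfl fun i _ => ?_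
      rw [hsym i j]; ring
    simp only [Finset.sum_add_distrib]
    rw [hPc]; ring
  rw [hdiv, htime]
  have hf2 : (ut - Lu - g * u) ^ 2 ≤ 2 * C ^ 2 * (S + u ^ 2) := by
    have h1 := sq_le_sq' (neg_le_of_abs_le hf) (le_of_abs_le hf)
    have h2 : (√S + |u|) ^ 2 ≤ 2 * (S + u ^ 2) := by
      nlinarith [sq_nonneg (√S - |u|), Real.sq_sqrt hS0, sq_abs u]
    calc _ ≤ C ^ 2 * (√S + |u|) ^ 2 := by rw [← mul_pow]; exact h1
      _ ≤ C ^ 2 * (2 * (S + u ^ 2)) := by gcongr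
      _ = _ := by ring
  set f := ut - Lu - g * u with hfdef
  set m := M ^ 2 * (n : ℝ) ^ 3
  have hm : 0 ≤ m := by positivity
  set B := 4 * C ^ 2 + 2 * m
  have hF : (f - b) ^ 2 ≤ B * (S + u ^ 2) := by
    have : (f - b) ^ 2 ≤ 2 * f ^ 2 + 2 * b ^ 2 := by nlinarith [sq_nonneg (f + b)]
    have h3 : 0 ≤ m * u ^ 2 := by positivity
    simp only [B]
    linarith
  have hLu' : b + Lu = ut - g * u - (f - b) := by rw [hfdef]; ring
  rw [hLu']
  generalize f - b = F at hF
  have h1 := mul_le_mul_of_nonneg_left hell (show 0 ≤ 2 * k by linarith)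
  have h2 := mul_le_mul_of_nonneg_right hkμ hS0
  have h3 := mul_le_mul_of_nonneg_right hg (sq_nonneg u)
  have h4 := sq_nonneg (ut - F)
  have h5 := sq_nonneg (k * u - F)
  have h7 := sq_nonneg ut
  clear_value S Lu b Q R P N f m B
  clear * - h1 h2 h3 h4 h5 h7 hF hRle
  linarith

/-- Carleman-type energy estimate for the conjugated parabolic inequality
`|u_t - L u - g u| ≤ C (|∇u| + |u|)`, with a rapidly increasing potential `g`. -/
theorem conjugated_energy_estimate {n : ℕ} {Ω : Set (Fin n → ℝ)} (hΩ : IsOpen Ω)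
    (hb : Bornology.IsBounded Ω) {T : ℝ} (hT : 0 < T) {V : Set ((Fin n → ℝ) × ℝ)}
    (hV : IsOpen V) (hsub : closure (Ω ×ˢ Ioo (0 : ℝ) T) ⊆ V)
    {a : Fin n → Fin n → (Fin n → ℝ) × ℝ → ℝ} (hsym : ∀ i j, a i j = a j i)
    (ha : ∀ i j, ContDiffOn ℝ 1 (a i j) V) {μ₁ μ₂ : ℝ} (hμ₁ : 0 < μ₁)
    (hell : ∀ p ∈ closure (Ω ×ˢ Ioo (0 : ℝ) T), ∀ ξ : Fin n → ℝ,
      μ₁ * ∑ i, ξ i ^ 2 ≤ ∑ i, ∑ j, a i j p * ξ i * ξ j ∧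
      ∑ i, ∑ j, a i j p * ξ i * ξ j ≤ μ₂ * ∑ i, ξ i ^ 2)
    {M : ℝ} (hM : 0 ≤ M)
    (haT : ∀ p ∈ closure (Ω ×ˢ Ioo (0 : ℝ) T), ∀ i j, |timeDeriv (a i j) p| ≤ M)
    (haX : ∀ p ∈ closure (Ω ×ˢ Ioo (0 : ℝ) T), ∀ i j, |spaceDeriv i (a i j) p| ≤ M)
    (hdiv : ∀ W : Fin n → (Fin n → ℝ) → ℝ → ℝ,
      (∀ j, ∃ V : Set ((Fin n → ℝ) × ℝ), IsOpen V ∧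
        closure (Ω ×ˢ Ioo (0 : ℝ) T) ⊆ V ∧ ContDiffOn ℝ 1 (fun p => W j p.1 p.2) V) →
      (∀ j, ∀ x ∈ frontier Ω, ∀ t ∈ Ioo (0 : ℝ) T, W j x t = 0) →
      (∫ p in Ω ×ˢ Ioo (0 : ℝ) T, ∑ j, partialX j (W j) p.1 p.2) = 0)
    {C k : ℝ} (hk : 0 ≤ k)
    (hkμ : M * n + 2 * (4 * C ^ 2 + 2 * (M ^ 2 * n ^ 3)) + 1 ≤ 2 * k * μ₁)
    {g g' : ℝ → ℝ} (hg : ContDiffOn ℝ 1 (fun p : (Fin n → ℝ) × ℝ => g p.2) V)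
    (hg' : ∀ t ∈ Ioo 0 T, HasDerivAt g (g' t) t) (hg0 : k ≤ g 0)
    (hgrow : ∀ t ∈ Ioo 0 T,
      1 + 2 * (4 * C ^ 2 + 2 * (M ^ 2 * n ^ 3)) + k ^ 2 + 2 * k * g t ≤ g' t)
    {u : (Fin n → ℝ) × ℝ → ℝ} (hu : ContDiffOn ℝ 2 u V)
    (hu0 : ∀ x ∈ frontier Ω, ∀ t ∈ Ioo (0 : ℝ) T, u (x, t) = 0)
    (hineq : ∀ p ∈ Ω ×ˢ Ioo (0 : ℝ) T,
      |timeDeriv u p - (∑ i, ∑ j, a i j p * spaceDeriv i (spaceDeriv j u) p) - g p.2 * u p|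
        ≤ C * (√(∑ i, spaceDeriv i u p ^ 2) + |u p|)) :
    ∫ p in Ω ×ˢ Ioo 0 T, ((∑ i, spaceDeriv i u p ^ 2) + u p ^ 2)
      ≤ μ₂ * (∫ x in Ω, ∑ i, spaceDeriv i u (x, 0) ^ 2) + g T * ∫ x in Ω, u (x, T) ^ 2 := by
  have hu1 : ContDiffOn ℝ 1 u V := hu.of_le (by norm_num)
  have hd : ∀ i, ContDiffOn ℝ 1 (spaceDeriv i u) V := fun i => hu.spaceDeriv hV (by norm_num) i
  have hut : ContDiffOn ℝ 1 (timeDeriv u) V := hu.timeDeriv hV (by norm_num)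
  have hcl := closure_cylinder Ω hT
  set W : Fin n → (Fin n → ℝ) × ℝ → ℝ := fun j p =>
    (timeDeriv u p + k * u p) * ∑ i, a j i p * spaceDeriv i u p with hWdef
  set H : (Fin n → ℝ) × ℝ → ℝ := fun p =>
    (∑ i, ∑ j, a i j p * spaceDeriv i u p * spaceDeriv j u p) - g p.2 * u p ^ 2 + k * u p ^ 2
    with hHdef
  have hW : ∀ j, ContDiffOn ℝ 1 (W j) V := fun j =>
    (hut.add (contDiffOn_const.mul hu1)).mul
      (ContDiffOn.sum fun i _ => (ha j i).mul (hd i))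
  have hH : ContDiffOn ℝ 1 H V :=
    ((ContDiffOn.sum fun i _ => ContDiffOn.sum fun j _ => ((ha i j).mul (hd i)).mul (hd j)).sub
      (hg.mul (hu1.pow 2))).add (contDiffOn_const.mul (hu1.pow 2))
  have hdiff : ∀ {f : (Fin n → ℝ) × ℝ → ℝ}, ContDiffOn ℝ 1 f V → ∀ p ∈ V,
      DifferentiableAt ℝ f p := fun hf p hp =>
    (hf.differentiableOn (by norm_num)).differentiableAt (hV.mem_nhds hp)
  have hQV : ∀ p ∈ Ω ×ˢ Ioo (0 : ℝ) T, p ∈ V := fun p hp => hsub (subset_closure hp)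
  have hWzero : ∫ p in Ω ×ˢ Ioo 0 T, ∑ j, spaceDeriv j (W j) p = 0 := by
    refine Eq.trans ?_ (hdiv (fun j x t => W j (x, t)) (fun j => ⟨V, hV, hsub, hW j⟩) ?_)
    · refine setIntegral_congr_fun (hΩ.measurableSet.prod measurableSet_Ioo) fun p hp => ?_
      exact Finset.sum_congr rfl fun j _ =>
        (partialX_eq_spaceDeriv (u := fun x t => W j (x, t)) j (hdiff (hW j) p (hQV p hp))).symm
    · intro j x hx t ht
      have hxt : (x, t) ∈ V := hsub (by
        rw [hcl]; exact ⟨frontier_subset_closure hx, Ioo_subset_Icc_self ht⟩)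
      have h0 : (fun s => u (x, s)) =ᶠ[nhds t] fun _ => 0 := by
        filter_upwards [isOpen_Ioo.mem_nhds ht] with s hs using hu0 x hx s hs
      have h1 : timeDeriv u (x, t) = 0 := by
        rw [← (hasDerivAt_slice_time (hdiff hu1 _ hxt)).deriv, h0.deriv_eq, deriv_const]
      simp [hWdef, h1, hu0 x hx t ht]
  have hWd : ∀ p ∈ V, ∀ j, spaceDeriv j (W j) p =
      (timeDeriv (spaceDeriv j u) p + k * spaceDeriv j u p) * (∑ i, a j i p * spaceDeriv i u p)
        + (timeDeriv u p + k * u p) * ∑ i, (spaceDeriv j (a j i) p * spaceDeriv i u p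
          + a j i p * spaceDeriv j (spaceDeriv i u) p) := by
    intro p hp j
    have h1 := (hdiff hut p hp).hasFDerivAt.add ((hdiff hu1 p hp).hasFDerivAt.const_mul k)
    have h2 := HasFDerivAt.fun_sum (u := Finset.univ) fun i _ =>
      (hdiff (ha j i) p hp).hasFDerivAt.mul (hdiff (hd i) p hp).hasFDerivAt
    rw [← spaceDeriv_timeDeriv_comm hV hu hp]
    have h3 : fderiv ℝ (W j) p = _ := (h1.mul h2).fderiv
    rw [spaceDeriv, h3]
    simp only [spaceDeriv, Pi.add_apply, add_apply, smul_apply,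
      FunLike.coe_sum, Finset.sum_apply, smul_eq_mul]
    rw [add_comm, mul_comm (∑ i, _)]
    refine congrArg₂ _ rfl (congrArg _ (Finset.sum_congr rfl fun i _ => ?_))
    ring
  have hHd : ∀ p ∈ Ω ×ˢ Ioo (0 : ℝ) T, timeDeriv H p =
      (∑ i, ∑ j, (timeDeriv (a i j) p * spaceDeriv i u p * spaceDeriv j u p
          + a i j p * timeDeriv (spaceDeriv i u) p * spaceDeriv j u p
          + a i j p * spaceDeriv i u p * timeDeriv (spaceDeriv j u) p))
        - g' p.2 * u p ^ 2 + 2 * (k - g p.2) * u p * timeDeriv u p := by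
    intro p hp
    have hpV := hQV p hp
    have h1 := HasFDerivAt.fun_sum (u := Finset.univ) fun i _ =>
      HasFDerivAt.fun_sum (u := Finset.univ) fun j _ =>
      ((hdiff (ha i j) p hpV).hasFDerivAt.mul (hdiff (hd i) p hpV).hasFDerivAt).mul
        (hdiff (hd j) p hpV).hasFDerivAt
    have h2 := (hdiff hu1 p hpV).hasFDerivAt.pow 2
    have h3 := (hg' p.2 hp.2).comp_hasFDerivAt p
      (hasFDerivAt_snd (𝕜 := ℝ) (E := Fin n → ℝ) (F := ℝ))
    have h4 : fderiv ℝ H p = _ := ((h1.sub (h3.mul h2)).add (h2.const_mul k)).fderiv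
    rw [timeDeriv, h4]
    simp only [timeDeriv, Pi.mul_apply, Function.comp_apply, add_apply, sub_apply,
      smul_apply, FunLike.coe_sum, Finset.sum_apply, smul_eq_mul, ContinuousLinearMap.coe_snd',
      nsmul_eq_mul, Nat.cast_ofNat, Nat.add_one_sub_one, pow_one]
    rw [sub_add, sub_add]
    refine congrArg₂ _ (Finset.sum_congr rfl fun i _ => Finset.sum_congr rfl fun j _ => ?_) ?_ <;>
      ring
  have hbQ : Bornology.IsBounded (Ω ×ˢ Ioo (0 : ℝ) T) := hb.prod (Metric.isBounded_Ioo 0 T)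
  have hWint : IntegrableOn (fun p => 2 * ∑ j, spaceDeriv j (W j) p) (Ω ×ˢ Ioo 0 T) :=
    integrableOn_of_continuousOn_closure hbQ (ContinuousOn.mono (continuousOn_const.mul
      (continuousOn_finsetSum _ fun j _ =>
        ((hW j).spaceDeriv (m := 0) hV (by norm_num) j).continuousOn)) hsub)
  have hHint : IntegrableOn (timeDeriv H) (Ω ×ˢ Ioo 0 T) :=
    integrableOn_of_continuousOn_closure hbQ
      ((hH.timeDeriv (m := 0) hV (by norm_num)).continuousOn.mono hsub)
  have hS : ContinuousOn (fun p => ∑ i, spaceDeriv i u p ^ 2) V :=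
    continuousOn_finsetSum _ fun i _ => (hd i).continuousOn.pow 2
  have hLint : IntegrableOn (fun p => (∑ i, spaceDeriv i u p ^ 2) + u p ^ 2) (Ω ×ˢ Ioo 0 T) :=
    integrableOn_of_continuousOn_closure hbQ ((hS.add (hu1.continuousOn.pow 2)).mono hsub)
  have hslice : ∀ {f : (Fin n → ℝ) × ℝ → ℝ}, ContinuousOn f V → ∀ t ∈ Icc 0 T,
      IntegrableOn (fun x => f (x, t)) Ω := fun hf t ht =>
    integrableOn_of_continuousOn_closure hb (continuousOn_slice hT hsub hf ht)
  have h0T : (0 : ℝ) ∈ Icc 0 T := ⟨le_rfl, hT.le⟩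
  have hTT : T ∈ Icc 0 T := ⟨hT.le, le_rfl⟩
  have hmain : ∫ p in Ω ×ˢ Ioo 0 T, ((∑ i, spaceDeriv i u p ^ 2) + u p ^ 2)
      ≤ ∫ p in Ω ×ˢ Ioo 0 T, (2 * (∑ j, spaceDeriv j (W j) p) - timeDeriv H p) := by
    refine setIntegral_mono_on hLint (hWint.sub hHint) (hΩ.measurableSet.prod measurableSet_Ioo)
      fun p hp => ?_
    have hpc := subset_closure hp
    rw [hHd p hp, Finset.sum_congr rfl fun j _ => hWd p (hQV p hp) j]
    exact energy_pointwise (fun i j => a i j p) (fun i j => timeDeriv (a i j) p)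
      (fun j i => spaceDeriv j (a j i) p) (fun i j => spaceDeriv i (spaceDeriv j u) p) _ _ _ _ _ _
      k μ₁ C M (fun i j => by rw [hsym i j]) hM hk (hell p hpc _).1 (haT p hpc) (haX p hpc)
      (hineq p hp) hkμ (hgrow p.2 hp.2)
  rw [integral_sub hWint hHint, integral_const_mul, hWzero,
    setIntegral_timeDeriv hΩ hb hT hV hsub hH] at hmain
  have hend0 : ∫ x in Ω, H (x, 0) ≤ μ₂ * ∫ x in Ω, ∑ i, spaceDeriv i u (x, 0) ^ 2 := by
    rw [← integral_const_mul]
    refine setIntegral_mono_on (hslice hH.continuousOn 0 h0T)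
      ((hslice hS 0 h0T).const_mul _) hΩ.measurableSet fun x hx => ?_
    have := (hell (x, 0) (by rw [hcl]; exact ⟨subset_closure hx, h0T⟩)
      fun i => spaceDeriv i u (x, 0)).2
    have h2 := mul_le_mul_of_nonneg_right hg0 (sq_nonneg (u (x, 0)))
    simp only [hHdef]
    linarith
  have hendT : -∫ x in Ω, H (x, T) ≤ g T * ∫ x in Ω, u (x, T) ^ 2 := by
    rw [← integral_const_mul, ← integral_neg]
    refine setIntegral_mono_on (hslice hH.continuousOn T hTT).neg
      ((hslice (hu1.continuousOn.pow 2) T hTT).const_mul _) hΩ.measurableSet fun x hx => ?_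
    have h1 := (hell (x, T) (by rw [hcl]; exact ⟨subset_closure hx, hTT⟩)
      fun i => spaceDeriv i u (x, T)).1
    have h2 : 0 ≤ μ₁ * ∑ i, spaceDeriv i u (x, T) ^ 2 := by positivity
    have h3 := mul_nonneg hk (sq_nonneg (u (x, T)))
    simp only [hHdef]
    linarith
  linarith

theorem IsCompact.exists_forall_abs_le {X ι : Type*} [TopologicalSpace X] [Fintype ι] {K : Set X}
    (hK : IsCompact K) {f : ι → X → ℝ} (hf : ∀ i, ContinuousOn (f i) K) :
    ∃ M, 0 ≤ M ∧ ∀ x ∈ K, ∀ i, |f i x| ≤ M := by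
  choose B hB using fun i => hK.exists_bound_of_continuousOn (hf i)
  refine ⟨∑ i, |B i|, Finset.sum_nonneg fun i _ => abs_nonneg _, fun x hx i => ?_⟩
  calc |f i x| ≤ |B i| := (hB i x hx).trans (le_abs_self _)
    _ ≤ _ := Finset.single_le_sum (f := fun i => |B i|) (fun i _ => abs_nonneg _)
      (Finset.mem_univ i)

theorem mul_rpow_sub_one_le_exp {T : ℝ} (hT : 0 < T) (ν : ℝ) :
    ν * (T + 1) ^ (ν - 1) ≤ 2 / log (T + 1) * exp ((T + 1) ^ ν) := by
  have hlog : 0 < log (T + 1) := log_pos (by linarith)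
  set x := (T + 1) ^ ν with hx
  have hx0 : 0 ≤ x := by positivity
  have h1 : (T + 1) ^ (ν - 1) ≤ x := rpow_le_rpow_of_exponent_le (by linarith) (by linarith)
  have h2 : ν * log (T + 1) ≤ x := by
    rw [hx, rpow_def_of_pos (by linarith)]
    linarith [add_one_le_exp (log (T + 1) * ν)]
  have h3 := quadratic_le_exp_of_nonneg hx0
  rw [div_mul_eq_mul_div, le_div_iff₀ hlog]
  have h4 : ν * log (T + 1) * (T + 1) ^ (ν - 1) ≤ x * x :=
    mul_le_mul h2 h1 (by positivity) hx0
  linarith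

theorem weight_growth {T ν k D t : ℝ} (hk : 0 ≤ k) (hD : 0 ≤ D)
    (hν : 4 + 2 * k * (T + 1) + D ≤ ν) (ht : t ∈ Icc 0 T) :
    D + 2 * k * (ν * (t + 1) ^ (ν - 1)) ≤ ν * ((ν - 1) * (t + 1) ^ (ν - 2)) := by
  obtain ⟨ht0, htT⟩ := ht
  have hkt : k * (t + 1) ≤ k * (T + 1) := by gcongr
  have hkt0 : 0 ≤ k * (t + 1) := by positivity
  have h1 : (1 : ℝ) ≤ (t + 1) ^ (ν - 2) := one_le_rpow (by linarith) (by linarith)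
  have h2 : (t + 1) ^ (ν - 1) = (t + 1) ^ (ν - 2) * (t + 1) := by
    rw [← rpow_add_one (by linarith)]; congr 1; ring
  have h3 : D * 1 ≤ ν * (t + 1) ^ (ν - 2) := mul_le_mul (by linarith) h1 zero_le_one (by linarith)
  have h4 : 0 ≤ ν * (t + 1) ^ (ν - 2) * (ν - 2 - 2 * (k * (t + 1))) :=
    mul_nonneg (mul_nonneg (by linarith) (by linarith)) (by linarith)
  rw [h2]
  linarith

theorem hasDerivAt_exp_rpow {ν t : ℝ} (ht : -1 < t) :
    HasDerivAt (fun s : ℝ => exp ((s + 1) ^ ν)) (exp ((t + 1) ^ ν) * (ν * (t + 1) ^ (ν - 1))) t := by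
  have h := ((hasDerivAt_id t).add_const 1).rpow_const (p := ν) (Or.inl (by simp; linarith))
  simpa using h.exp

/-- **weighted stability estimate (3.6).** -/
theorem stability_estimate_differential_inequality
    (n : ℕ) (hn : 1 ≤ n) (T : ℝ) (hT : 0 < T)
    (Ω : Set (Fin n → ℝ)) (hΩopen : IsOpen Ω) (hΩconn : IsConnected Ω)
    (hΩbdd : Bornology.IsBounded Ω)
    (a : Fin n → Fin n → (Fin n → ℝ) → ℝ → ℝ)
    (hsym : ∀ i j, a i j = a j i)
    (ha : ∀ i j, ∃ V : Set ((Fin n → ℝ) × ℝ), IsOpen V ∧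
        closure (Ω ×ˢ Ioo (0:ℝ) T) ⊆ V ∧ ContDiffOn ℝ 1 (fun p => a i j p.1 p.2) V)
    (μ₁ μ₂ : ℝ) (hμ₁ : 0 < μ₁) (hμ₁₂ : μ₁ ≤ μ₂)
    (hell : ∀ p ∈ closure (Ω ×ˢ Ioo (0:ℝ) T), ∀ ξ : Fin n → ℝ,
      μ₁ * ∑ i, ξ i ^ 2 ≤ ∑ i, ∑ j, a i j p.1 p.2 * ξ i * ξ j ∧
      ∑ i, ∑ j, a i j p.1 p.2 * ξ i * ξ j ≤ μ₂ * ∑ i, ξ i ^ 2)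
    -- the divergence property of Ω
    (hdiv : ∀ W : Fin n → (Fin n → ℝ) → ℝ → ℝ,
      (∀ j, ∃ V : Set ((Fin n → ℝ) × ℝ), IsOpen V ∧
        closure (Ω ×ˢ Ioo (0:ℝ) T) ⊆ V ∧ ContDiffOn ℝ 1 (fun p => W j p.1 p.2) V) →
      (∀ j, ∀ x ∈ frontier Ω, ∀ t ∈ Ioo (0:ℝ) T, W j x t = 0) →
      (∫ p in Ω ×ˢ Ioo (0:ℝ) T, ∑ j, partialX j (W j) p.1 p.2) = 0)
    (C' : ℝ) (hC' : 0 < C') :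
    ∃ C₁ : ℝ, 0 < C₁ ∧ ∃ ν₁ : ℝ, 1 < ν₁ ∧
      ∀ w : (Fin n → ℝ) → ℝ → ℝ,
        (∃ V : Set ((Fin n → ℝ) × ℝ), IsOpen V ∧
          closure (Ω ×ˢ Ioo (0:ℝ) T) ⊆ V ∧ ContDiffOn ℝ 2 (fun p => w p.1 p.2) V) →
        (∀ x ∈ frontier Ω, ∀ t ∈ Ioo (0:ℝ) T, w x t = 0) →
        (∀ x ∈ Ω, ∀ t ∈ Ioo (0:ℝ) T,
          |partialT w x t - Lop a w x t| ≤
            C' * (Real.sqrt (∑ i, (partialX i w x t) ^ 2) + |w x t|)) →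
        ∀ ν : ℝ, ν₁ ≤ ν → ∀ τ ∈ Ioo (0:ℝ) T,
          (∫ p in Ω ×ˢ Ioo τ T,
              (∑ i, (partialX i w p.1 p.2) ^ 2) + (w p.1 p.2) ^ 2)
            ≤ C₁ * exp (3 * (T + 1) ^ ν) * (∫ x in Ω, (w x T) ^ 2)
              + C₁ * exp (-2 * (τ + 1) ^ ν) * ∫ x in Ω, ∑ i, (partialX i w x 0) ^ 2 := by
  choose Va hVa hVasub haV using ha
  set A : Fin n → Fin n → (Fin n → ℝ) × ℝ → ℝ := fun i j p => a i j p.1 p.2 with hA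
  have hbQ : Bornology.IsBounded (Ω ×ˢ Ioo (0 : ℝ) T) := hΩbdd.prod (Metric.isBounded_Ioo 0 T)
  have hK : IsCompact (closure (Ω ×ˢ Ioo (0 : ℝ) T)) := hbQ.isCompact_closure
  have hcl := closure_cylinder Ω hT
  obtain ⟨M₁, hM₁, hMT⟩ := hK.exists_forall_abs_le
    (f := fun ij : Fin n × Fin n => timeDeriv (A ij.1 ij.2)) fun ij =>
      ((haV ij.1 ij.2).timeDeriv (m := 0) (hVa _ _) (by norm_num)).continuousOn.mono (hVasub _ _)
  obtain ⟨M₂, hM₂, hMX⟩ := hK.exists_forall_abs_le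
    (f := fun ij : Fin n × Fin n => spaceDeriv ij.1 (A ij.1 ij.2)) fun ij =>
      ((haV ij.1 ij.2).spaceDeriv (m := 0) (hVa _ _) (by norm_num) _).continuousOn.mono
        (hVasub _ _)
  set M := max M₁ M₂
  have hM : 0 ≤ M := hM₁.trans (le_max_left _ _)
  set B := 4 * C' ^ 2 + 2 * (M ^ 2 * (n : ℝ) ^ 3) with hB
  have hB0 : 0 ≤ B := by positivity
  set k := (M * n + 2 * B + 1) / (2 * μ₁) with hkdef
  have hk : 0 ≤ k := by positivity
  have hkμ : M * n + 2 * B + 1 ≤ 2 * k * μ₁ := by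
    rw [hkdef]; field_simp; rfl
  have hlog : 0 < log (T + 1) := log_pos (by linarith)
  have hμ₂ : 0 < μ₂ := hμ₁.trans_le hμ₁₂
  refine ⟨μ₂ * exp 2 + 2 / log (T + 1), by positivity,
    4 + 2 * k * (T + 1) + (1 + 2 * B + k ^ 2) + k, ?_, ?_⟩
  · have : 0 ≤ 2 * k * (T + 1) := by positivity
    linarith [sq_nonneg k]
  rintro w ⟨Vw, hVw, hVwsub, hw⟩ hw0 hineq ν hν τ hτ
  set w' : (Fin n → ℝ) × ℝ → ℝ := fun p => w p.1 p.2 with hw'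
  have hkT : 0 ≤ 2 * k * (T + 1) := by positivity
  have hνpos : 0 < ν := by linarith [sq_nonneg k]
  set V := (⋂ i, ⋂ j, Va i j) ∩ Vw ∩ {p | -1 < p.2} with hVdef
  have hV : IsOpen V := ((isOpen_iInter_of_finite fun i => isOpen_iInter_of_finite (hVa i)).inter
    hVw).inter (isOpen_lt continuous_const continuous_snd)
  have hsub : closure (Ω ×ˢ Ioo (0 : ℝ) T) ⊆ V := fun p hp =>
    ⟨⟨mem_iInter₂.2 fun i j => hVasub i j hp, hVwsub hp⟩, by
      rw [hcl] at hp
      exact lt_of_lt_of_le (by norm_num) hp.2.1⟩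
  have hVt : ∀ p ∈ V, -1 < p.2 := fun p hp => hp.2
  have haV' : ∀ i j, ContDiffOn ℝ 1 (A i j) V := fun i j =>
    (haV i j).mono fun p hp => mem_iInter₂.1 hp.1.1 i j
  have hwV : ContDiffOn ℝ 2 w' V := hw.mono fun p hp => hp.1.2
  have hrpow : ∀ (m : WithTop ℕ∞) (r : ℝ),
      ContDiffOn ℝ m (fun p : (Fin n → ℝ) × ℝ => (p.2 + 1) ^ r) V := fun m r =>
    ContDiffOn.rpow_const_of_ne (contDiffOn_snd.add contDiffOn_const)
      fun p hp => by linarith [hVt p hp]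
  set θ : ℝ → ℝ := fun t => exp ((t + 1) ^ ν) with hθ
  set g : ℝ → ℝ := fun t => ν * (t + 1) ^ (ν - 1) with hg
  set u : (Fin n → ℝ) × ℝ → ℝ := fun p => w' p * θ p.2 with hu
  have huV : ContDiffOn ℝ 2 u V := hwV.mul (hrpow 2 ν).exp
  have hgV : ContDiffOn ℝ 1 (fun p : (Fin n → ℝ) × ℝ => g p.2) V :=
    contDiffOn_const.mul (hrpow 1 (ν - 1))
  have hθd : ∀ t, -1 < t → HasDerivAt θ (θ t * g t) t := fun t ht => hasDerivAt_exp_rpow ht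
  have hwd : ∀ p ∈ V, DifferentiableAt ℝ w' p := fun p hp =>
    (hwV.differentiableOn (by norm_num)).differentiableAt (hV.mem_nhds hp)
  have hux : ∀ p ∈ V, ∀ i, spaceDeriv i u p = spaceDeriv i w' p * θ p.2 := fun p hp i =>
    spaceDeriv_mul_time (hwd p hp) (hθd _ (hVt p hp)).differentiableAt i
  have hut : ∀ p ∈ V, timeDeriv u p = timeDeriv w' p * θ p.2 + w' p * (θ p.2 * g p.2) :=
    fun p hp => timeDeriv_mul_time (hwd p hp) (hθd _ (hVt p hp))
  have huxx : ∀ p ∈ V, ∀ i j,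
      spaceDeriv i (spaceDeriv j u) p = spaceDeriv i (spaceDeriv j w') p * θ p.2 := by
    intro p hp i j
    have heq : spaceDeriv j u =ᶠ[nhds p] fun q => spaceDeriv j w' q * θ q.2 := by
      filter_upwards [hV.mem_nhds hp] with q hq using hux q hq j
    rw [spaceDeriv_congr i heq]
    exact spaceDeriv_mul_time (((hwV.spaceDeriv (m := 1) hV (by norm_num) j).differentiableOn
      (by norm_num)).differentiableAt (hV.mem_nhds hp)) (hθd _ (hVt p hp)).differentiableAt i
  have hθpos : ∀ t, 0 < θ t := fun t => exp_pos _
  have hgrad : ∀ p ∈ V, ∑ i, spaceDeriv i u p ^ 2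
      = θ p.2 ^ 2 * ∑ i, partialX i w p.1 p.2 ^ 2 := by
    intro p hp
    rw [Finset.mul_sum]
    refine Finset.sum_congr rfl fun i _ => ?_
    rw [hux p hp, partialX_eq_spaceDeriv i (hwd p hp)]
    ring
  have hest := conjugated_energy_estimate hΩopen hΩbdd hT hV hsub (a := A)
    (fun i j => by simp only [hA, hsym i j]) haV' hμ₁ hell hM
    (fun p hp i j => (hMT p hp (i, j)).trans (le_max_left _ _))
    (fun p hp i j => (hMX p hp (i, j)).trans (le_max_right _ _)) hdiv hk hkμ hgV
    (g' := fun t => ν * ((ν - 1) * (t + 1) ^ (ν - 2))) ?_ ?_ ?_ huV ?_ ?_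
  rotate_left
  · intro t ht
    have h := (((hasDerivAt_id t).add_const 1).rpow_const (p := ν - 1)
      (Or.inl (by simp; linarith [ht.1]))).const_mul ν
    refine h.congr_deriv ?_
    rw [show ν - 1 - 1 = ν - 2 by ring]
    simp only [id]
    ring
  · simp only [hg, zero_add, one_rpow, mul_one]
    linarith [sq_nonneg k]
  · intro t ht
    exact weight_growth hk (by positivity) (by linarith) (Ioo_subset_Icc_self ht)
  · intro x hx t ht
    simp [hu, hw', hw0 x hx t ht]
  · intro p hp
    have hpV : p ∈ V := hsub (subset_closure hp)
    have hθp := hθpos p.2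
    have e1 : timeDeriv u p - (∑ i, ∑ j, A i j p * spaceDeriv i (spaceDeriv j u) p) - g p.2 * u p
        = θ p.2 * (partialT w p.1 p.2 - Lop a w p.1 p.2) := by
      have e2 : ∑ i, ∑ j, A i j p * spaceDeriv i (spaceDeriv j u) p
          = θ p.2 * Lop a w p.1 p.2 := by
        simp only [Lop, Finset.mul_sum]
        refine Finset.sum_congr rfl fun i _ => Finset.sum_congr rfl fun j _ => ?_
        rw [huxx p hpV, partialX_partialX_eq_spaceDeriv hV hwV hpV]
        ring
      rw [e2, hut p hpV, partialT_eq_timeDeriv (hwd p hpV)]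
      simp only [hu]
      ring
    rw [e1, hgrad p hpV, sqrt_mul (sq_nonneg _), sqrt_sq hθp.le, abs_mul, abs_of_pos hθp]
    simp only [hu]
    rw [abs_mul, abs_of_pos hθp]
    calc _ ≤ θ p.2 * (C' * (√(∑ i, partialX i w p.1 p.2 ^ 2) + |w p.1 p.2|)) :=
          mul_le_mul_of_nonneg_left (hineq p.1 hp.1 p.2 hp.2) hθp.le
      _ = _ := by simp only [hw']; ring
  have hslice : ∀ t ∈ Icc 0 T, ∀ x ∈ Ω, (x, t) ∈ V := fun t ht x hx =>
    hsub (by rw [hcl]; exact ⟨subset_closure hx, ht⟩)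
  have hI0 : ∫ x in Ω, ∑ i, spaceDeriv i u (x, 0) ^ 2
      = exp 2 * ∫ x in Ω, ∑ i, partialX i w x 0 ^ 2 := by
    rw [← integral_const_mul]
    refine setIntegral_congr_fun hΩopen.measurableSet fun x hx => ?_
    rw [hgrad _ (hslice 0 ⟨le_rfl, hT.le⟩ x hx)]
    simp only [hθ, zero_add, one_rpow, ← exp_nat_mul]
    norm_num
  have hIT : ∫ x in Ω, u (x, T) ^ 2 = θ T ^ 2 * ∫ x in Ω, w x T ^ 2 := by
    rw [← integral_const_mul]
    exact integral_congr_ae (ae_of_all _ fun x => by simp only [hu, hw']; ring)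
  rw [hI0, hIT] at hest
  set I0 := ∫ x in Ω, ∑ i, partialX i w x 0 ^ 2
  set IT := ∫ x in Ω, w x T ^ 2
  have hI0nn : 0 ≤ I0 :=
    integral_nonneg fun x => Finset.sum_nonneg fun i _ => sq_nonneg _
  have hITnn : 0 ≤ IT := integral_nonneg fun x => sq_nonneg _
  set ε := exp (-2 * (τ + 1) ^ ν) with hε
  have hFcont : ContinuousOn (fun p => (∑ i, spaceDeriv i u p ^ 2) + u p ^ 2) V :=
    (continuousOn_finsetSum _ fun i _ =>
      (huV.spaceDeriv (m := 1) hV (by norm_num) i).continuousOn.pow 2).add (huV.continuousOn.pow 2)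
  have hFint := integrableOn_of_continuousOn_closure (μ := volume) hbQ (hFcont.mono hsub)
  have hsubQ : Ω ×ˢ Ioo τ T ⊆ Ω ×ˢ Ioo 0 T :=
    prod_mono_right (Ioo_subset_Ioo_left hτ.1.le)
  have hlow : ∫ p in Ω ×ˢ Ioo τ T, ((∑ i, partialX i w p.1 p.2 ^ 2) + w p.1 p.2 ^ 2)
      ≤ ε * ∫ p in Ω ×ˢ Ioo 0 T, ((∑ i, spaceDeriv i u p ^ 2) + u p ^ 2) := by
    rw [← integral_const_mul]
    calc _ ≤ ∫ p in Ω ×ˢ Ioo τ T, ε * ((∑ i, spaceDeriv i u p ^ 2) + u p ^ 2) := by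
          refine integral_mono_of_nonneg (ae_of_all _ fun p => by positivity)
            ((hFint.mono_set hsubQ).const_mul _) ?_
          refine (ae_restrict_iff' (hΩopen.measurableSet.prod measurableSet_Ioo)).2
            (ae_of_all _ fun p hp => ?_)
          have hpV : p ∈ V := hsub (subset_closure (hsubQ hp))
          simp only
          rw [hgrad p hpV]
          have hone : 1 ≤ ε * θ p.2 ^ 2 := by
            simp only [hε, hθ]
            rw [← exp_nat_mul, ← exp_add, one_le_exp_iff]
            have : (τ + 1) ^ ν ≤ (p.2 + 1) ^ ν :=
              rpow_le_rpow (by linarith [hτ.1]) (by linarith [hp.2.1]) hνpos.le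
            push_cast
            linarith
          have hnn : 0 ≤ (∑ i, partialX i w p.1 p.2 ^ 2) + w p.1 p.2 ^ 2 := by positivity
          calc _ ≤ ε * θ p.2 ^ 2 * ((∑ i, partialX i w p.1 p.2 ^ 2) + w p.1 p.2 ^ 2) :=
                le_mul_of_one_le_left hnn hone
            _ = _ := by simp only [hu, hw']; ring
      _ ≤ _ := setIntegral_mono_set (hFint.const_mul _)
          (ae_of_all _ fun p => by positivity) hsubQ.eventuallyLE
  have hε0 : 0 < ε := exp_pos _
  have hε1 : ε ≤ 1 := by
    rw [hε, exp_le_one_iff]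
    have : 0 ≤ (τ + 1) ^ ν := rpow_nonneg (by linarith [hτ.1]) _
    linarith
  have hgT : g T * θ T ^ 2 ≤ 2 / log (T + 1) * exp (3 * (T + 1) ^ ν) := by
    have h3 : exp (3 * (T + 1) ^ ν) = θ T * θ T ^ 2 := by
      simp only [hθ]
      rw [← exp_nat_mul, ← exp_add]
      congr 1
      push_cast
      ring
    rw [h3, ← mul_assoc]
    exact mul_le_mul_of_nonneg_right (mul_rpow_sub_one_le_exp hT ν) (sq_nonneg _)
  have hgT0 : 0 ≤ g T * θ T ^ 2 :=
    mul_nonneg (mul_nonneg hνpos.le (rpow_nonneg (by linarith) _)) (sq_nonneg _)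
  have hL : 0 ≤ 2 / log (T + 1) := by positivity
  calc _ ≤ ε * (μ₂ * (exp 2 * I0) + g T * (θ T ^ 2 * IT)) :=
        hlow.trans (mul_le_mul_of_nonneg_left hest hε0.le)
    _ = μ₂ * exp 2 * ε * I0 + ε * (g T * θ T ^ 2) * IT := by ring
    _ ≤ (μ₂ * exp 2 + 2 / log (T + 1)) * ε * I0
        + (μ₂ * exp 2 + 2 / log (T + 1)) * exp (3 * (T + 1) ^ ν) * IT := by
      have h : ε * (g T * θ T ^ 2) ≤ (μ₂ * exp 2 + 2 / log (T + 1)) * exp (3 * (T + 1) ^ ν) :=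
        calc ε * (g T * θ T ^ 2) ≤ g T * θ T ^ 2 := mul_le_of_le_one_left hgT0 hε1
          _ ≤ 2 / log (T + 1) * exp (3 * (T + 1) ^ ν) := hgT
          _ ≤ _ := by
            gcongr
            linarith [mul_pos hμ₂ (exp_pos 2)]
      refine add_le_add ?_ (mul_le_mul_of_nonneg_right h hITnn)
      gcongr
      linarith
    _ = _ := by ring
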